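/- arXiv:1811.09322 — 6 statements merged into one kernel-verified Lean document; each statement's English description precedes it below -/
import Mathlib

section
/- The sequence (u_n) has the closed form: for every n ∈ ℕ, u_n = (1 − (2n+3)·λ^{n+1} + (2n+3)·λ^{n+2} − λ^{2n+3}) / (p·(1−λ)·(1−λ^{n+1})·(1−λ^{n+2})). -/
/-- Closed form for the auxiliary sequence `u`. -/
theorem u_closed_form
    (q p lam : ℝ) (hq0 : 0 < q) (hq : q < 1 / 2) (hp : p = 1 - q) (hlam : lam = q / p)
    (u : ℕ → ℝ) (hu0 : u 0 = 1)
    (hu : ∀ n : ℕ, 1 ≤ n →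
      u n = lam * ((1 - lam ^ n) / (1 - lam ^ (n + 2))) * u (n - 1) +
        (1 / p) * ((1 - lam ^ (n + 1)) / (1 - lam ^ (n + 2)))) :
    ∀ n : ℕ,
      u n = (1 - (2 * (n : ℝ) + 3) * lam ^ (n + 1) + (2 * (n : ℝ) + 3) * lam ^ (n + 2)
          - lam ^ (2 * n + 3)) /
        (p * (1 - lam) * (1 - lam ^ (n + 1)) * (1 - lam ^ (n + 2))) := by
  have hp0 : 0 < p := by linarith
  have hl0 : 0 < lam := hlam ▸ div_pos hq0 hp0
  have hl1 : lam < 1 := by rw [hlam, div_lt_one hp0]; linarith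
  have hpl : p * (1 + lam) = 1 := by
    rw [hlam, mul_add, mul_div_cancel₀ _ hp0.ne']; linarith
  have hpow (k : ℕ) : 1 - lam ^ (k + 1) ≠ 0 :=
    (sub_pos.2 (pow_lt_one₀ hl0.le hl1 k.succ_ne_zero)).ne'
  have hsub : 1 - lam ≠ 0 := (sub_pos.2 hl1).ne'
  intro n
  induction n with
  | zero =>
    have h2 := hpow 1
    norm_num at h2 ⊢
    rw [hu0, eq_div_iff (by positivity)]
    linear_combination (1 - lam) ^ 3 * hpl
  | succ n ih =>
    rw [hu (n + 1) n.succ_pos, Nat.add_sub_cancel, ih]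
    have h1 := hpow n
    have h2 := hpow (n + 1)
    have h3 := hpow (n + 2)
    have e2 : lam ^ (n + 2) = lam ^ (n + 1) * lam := by ring
    have e3 : lam ^ (n + 3) = lam ^ (n + 1) * lam ^ 2 := by ring
    have e4 : lam ^ (2 * n + 3) = (lam ^ (n + 1)) ^ 2 * lam := by ring
    have e5 : lam ^ (2 * (n + 1) + 3) = (lam ^ (n + 1)) ^ 2 * lam ^ 3 := by ring
    simp only [add_assoc, Nat.reduceAdd] at h1 h2 h3 ⊢
    rw [e5, e4, e3, e2]
    rw [e2] at h2
    rw [e3] at h3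
    push_cast
    generalize lam ^ (n + 1) = a at *
    field_simp
    ring
end

section
/- For every integer M ≥ 3, the sequence (u_n) satisfies (u_{M−3} + u_{M−2})/2 = (1/p)·(1 − (M−1)·λ^{M−2} + (M−1)·λ^M − λ^{2M−2}) / ((1−λ)·(1−λ^{M−2})·(1−λ^M)). -/
/-- Multiplying the recursion by `(1 - lam ^ (n + 1)) * (1 - lam ^ (n + 2))` makes it linear with
constant coefficient `lam`, which yields this closed form. -/
theorem closed_form_of_recursion {c lam : ℝ} (h0 : 0 < lam) (h1 : lam < 1) (hc : c = 1 + lam)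
    {u : ℕ → ℝ} (hu0 : u 0 = 1)
    (hu : ∀ n : ℕ, 1 ≤ n →
      u n = lam * ((1 - lam ^ n) / (1 - lam ^ (n + 2))) * u (n - 1) +
        c * ((1 - lam ^ (n + 1)) / (1 - lam ^ (n + 2)))) (n : ℕ) :
    u n = c * (((1 - lam ^ (n + 1)) * (1 + lam ^ (n + 2))
        - 2 * ((n : ℝ) + 1) * lam ^ (n + 1) * (1 - lam)) /
      ((1 - lam) * (1 - lam ^ (n + 1)) * (1 - lam ^ (n + 2)))) := by
  have hne (k : ℕ) : 1 - lam ^ (k + 1) ≠ 0 :=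
    (sub_pos.2 (pow_lt_one₀ h0.le h1 k.succ_ne_zero)).ne'
  have hne1 : 1 - lam ≠ 0 := (sub_pos.2 h1).ne'
  induction n with
  | zero =>
    have h2 := hne 1
    norm_num at h2 ⊢
    rw [hu0, hc]
    field_simp
    ring
  | succ n ih =>
    have ha := hne n
    have hb := hne (n + 1)
    have hd := hne (n + 2)
    rw [hu (n + 1) n.succ_pos, Nat.add_sub_cancel, ih]
    simp only [Nat.cast_add, Nat.cast_one, pow_add, pow_one, add_assoc, Nat.reduceAdd] at ha hb hd ⊢
    generalize lam ^ n = x at *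
    rw [mul_comm x] at ha hb hd
    field_simp
    ring


theorem u_mean_of_two_terms
    (q p lam : ℝ) (hq0 : 0 < q) (hq : q < 1 / 2) (hp : p = 1 - q) (hlam : lam = q / p)
    (u : ℕ → ℝ) (hu0 : u 0 = 1)
    (hu : ∀ n : ℕ, 1 ≤ n →
      u n = lam * ((1 - lam ^ n) / (1 - lam ^ (n + 2))) * u (n - 1) +
        (1 / p) * ((1 - lam ^ (n + 1)) / (1 - lam ^ (n + 2)))) :
    ∀ M : ℕ, 3 ≤ M →
      (u (M - 3) + u (M - 2)) / 2 =
        (1 / p) * ((1 - ((M : ℝ) - 1) * lam ^ (M - 2) + ((M : ℝ) - 1) * lam ^ M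
            - lam ^ (2 * M - 2)) /
          ((1 - lam) * (1 - lam ^ (M - 2)) * (1 - lam ^ M))) := by
  intro M hM
  obtain ⟨n, rfl⟩ := Nat.exists_eq_add_of_le' hM
  have hp0 : 0 < p := by linarith
  have h0 : 0 < lam := hlam ▸ div_pos hq0 hp0
  have h1 : lam < 1 := by rw [hlam, div_lt_one hp0]; linarith
  have hc : 1 / p = 1 + lam := by rw [hlam]; field_simp; linarith
  have hne (k : ℕ) : 1 - lam ^ (k + 1) ≠ 0 :=
    (sub_pos.2 (pow_lt_one₀ h0.le h1 k.succ_ne_zero)).ne'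
  have hne1 : 1 - lam ≠ 0 := (sub_pos.2 h1).ne'
  have ha := hne n
  have hb := hne (n + 1)
  have hd := hne (n + 2)
  rw [show n + 3 - 3 = n by lia, show n + 3 - 2 = n + 1 by lia,
    show 2 * (n + 3) - 2 = n + n + 4 by lia,
    closed_form_of_recursion h0 h1 hc hu0 hu n,
    closed_form_of_recursion h0 h1 hc hu0 hu (n + 1)]
  generalize 1 / p = c
  simp only [Nat.cast_add, Nat.cast_one, Nat.cast_ofNat, pow_add, pow_one, add_assoc,
    Nat.reduceAdd] at ha hb hd ⊢
  generalize lam ^ n = x at *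
  field_simp
  ring
end

section
/- The sequence (u_n) converges, with lim_{n→∞} u_n = 1/(p−q). -/
open Filter Topology

/-- Closed form of the solution of the recursion with `1 / p = 1 + l`. -/
theorem recursion_closed_form {l : ℝ} (h0 : 0 < l) (h1 : l < 1) (u : ℕ → ℝ) (hu0 : u 0 = 1)
    (hu : ∀ n : ℕ, u (n + 1) = l * ((1 - l ^ (n + 1)) / (1 - l ^ (n + 3))) * u n +
      (1 + l) * ((1 - l ^ (n + 2)) / (1 - l ^ (n + 3)))) (n : ℕ) :
    u n = (1 + l) / (1 - l) *
      (1 - 2 * (1 - l) * l * (n * l ^ n) - l ^ 3 * (l ^ n) ^ 2 - 3 * l * (1 - l) * l ^ n) /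
      ((1 - l * l ^ n) * (1 - l ^ 2 * l ^ n)) := by
  have hl : 1 - l ≠ 0 := by linarith
  have hpow (k : ℕ) : 1 - l ^ (k + 1) ≠ 0 := by
    have := pow_lt_one₀ h0.le h1 k.succ_ne_zero
    exact (sub_pos.2 this).ne'
  induction n with
  | zero =>
    have h2 : 1 - l ^ 2 ≠ 0 := hpow 1
    rw [hu0]
    simp only [pow_zero, mul_one, Nat.cast_zero, mul_zero]
    field_simp
    ring
  | succ n ih =>
    have e1 := hpow n
    have e2 := hpow (n + 1)
    have e3 := hpow (n + 2)
    rw [hu, ih]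
    push_cast
    simp only [pow_succ, pow_zero, one_mul] at e1 e2 e3 ⊢
    generalize l ^ n = x at *
    have e1' : 1 - l * x ≠ 0 := by convert e1 using 1; ring
    have e2' : 1 - l ^ 2 * x ≠ 0 := by convert e2 using 1; ring
    have e3' : 1 - l ^ 3 * x ≠ 0 := by convert e3 using 1; ring
    rw [show x * l = l * x by ring, show l * x * l = l ^ 2 * x by ring,
      show l ^ 2 * x * l = l ^ 3 * x by ring, show l * l * x = l ^ 2 * x by ring,
      show l * (l * x) = l ^ 2 * x by ring, show l * l * (l * x) = l ^ 3 * x by ring]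
    field_simp
    ring

theorem u_tendsto
    (q p lam : ℝ) (hq0 : 0 < q) (hq : q < 1 / 2) (hp : p = 1 - q) (hlam : lam = q / p)
    (u : ℕ → ℝ) (hu0 : u 0 = 1)
    (hu : ∀ n : ℕ, 1 ≤ n →
      u n = lam * ((1 - lam ^ n) / (1 - lam ^ (n + 2))) * u (n - 1) +
        (1 / p) * ((1 - lam ^ (n + 1)) / (1 - lam ^ (n + 2)))) :
    Tendsto u atTop (𝓝 (1 / (p - q))) := by
  have hp0 : 0 < p := by linarith
  have hpq : p - q ≠ 0 := by linarith
  have h0 : 0 < lam := hlam ▸ div_pos hq0 hp0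
  have h1 : lam < 1 := by rw [hlam, div_lt_one hp0]; linarith
  have hinv : 1 / p = 1 + lam := by
    rw [hlam]
    field_simp
    linarith
  have hlim : 1 / (p - q) = (1 + lam) / (1 - lam) := by
    rw [← hinv, hlam]
    field_simp
  have key := recursion_closed_form h0 h1 u hu0 fun n => by
    have := hu (n + 1) (by omega)
    rwa [hinv] at this
  have hx : Tendsto (fun n : ℕ => lam ^ n) atTop (𝓝 0) :=
    tendsto_pow_atTop_nhds_zero_of_lt_one h0.le h1
  have hnx : Tendsto (fun n : ℕ => n * lam ^ n) atTop (𝓝 0) :=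
    tendsto_self_mul_const_pow_of_lt_one h0.le h1
  rw [funext key, hlim]
  have hnum := (((tendsto_const_nhds (x := (1 : ℝ))).sub
    (hnx.const_mul (2 * (1 - lam) * lam))).sub ((hx.pow 2).const_mul (lam ^ 3))).sub
    (hx.const_mul (3 * lam * (1 - lam)))
  have hden := ((hx.const_mul lam).const_sub 1).mul ((hx.const_mul (lam ^ 2)).const_sub 1)
  simpa [Pi.div_def] using (hnum.const_mul ((1 + lam) / (1 - lam))).div hden (by simp)
end

section
/- For every n ∈ ℕ, the sequence (u_n) satisfies the two-sided bound 0 ≤ 1/(p−q) − u_n ≤ λ^n·(1/(p−q) − 1) + (2n/(p−q))·λ^{n+1}. -/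
/-- With `L = (1 + x) / (1 - x)`, the gap `L - u` satisfies a contracting affine recursion
whose forcing term is proportional to `x ^ (n + 2)`. -/
theorem gap_recursion {x : ℝ} (hx0 : 0 < x) (hx1 : x < 1) (n : ℕ) (a : ℝ) :
    (1 + x) / (1 - x) - (x * ((1 - x ^ (n + 1)) / (1 - x ^ (n + 3))) * a +
        (1 + x) * ((1 - x ^ (n + 2)) / (1 - x ^ (n + 3)))) =
      x * ((1 - x ^ (n + 1)) / (1 - x ^ (n + 3))) * ((1 + x) / (1 - x) - a) +
        2 * ((1 + x) / (1 - x)) * x ^ (n + 2) * ((1 - x) / (1 - x ^ (n + 3))) := by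
  have h1 : 1 - x ≠ 0 := by linarith
  have h2 : 1 - x ^ (n + 3) ≠ 0 := by
    have := pow_lt_one₀ hx0.le hx1 (Nat.succ_ne_zero (n + 2))
    exact (sub_pos.2 this).ne'
  field_simp
  ring

/-- For `0 < x < 1` and `k ≤ m`, `m ≠ 0`, the ratio `(1 - x ^ k) / (1 - x ^ m)` lies in
`[0, 1]`. -/
theorem one_sub_pow_div_mem_Icc {x : ℝ} (hx0 : 0 < x) (hx1 : x < 1) {k m : ℕ} (hkm : k ≤ m)
    (hm : m ≠ 0) : (1 - x ^ k) / (1 - x ^ m) ∈ Set.Icc (0 : ℝ) 1 := by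
  have hpos : 0 < 1 - x ^ m := sub_pos.2 (pow_lt_one₀ hx0.le hx1 hm)
  refine ⟨div_nonneg (sub_nonneg.2 (pow_le_one₀ hx0.le hx1.le)) hpos.le, ?_⟩
  rw [div_le_one hpos]
  exact sub_le_sub_left (pow_le_pow_of_le_one hx0.le hx1.le hkm) 1

theorem u_two_sided_bound
    (q p lam : ℝ) (hq0 : 0 < q) (hq : q < 1 / 2) (hp : p = 1 - q) (hlam : lam = q / p)
    (u : ℕ → ℝ) (hu0 : u 0 = 1)
    (hu : ∀ n : ℕ, 1 ≤ n →
      u n = lam * ((1 - lam ^ n) / (1 - lam ^ (n + 2))) * u (n - 1) +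
        (1 / p) * ((1 - lam ^ (n + 1)) / (1 - lam ^ (n + 2)))) :
    ∀ n : ℕ,
      0 ≤ 1 / (p - q) - u n ∧
      1 / (p - q) - u n ≤
        lam ^ n * (1 / (p - q) - 1) + (2 * (n : ℝ) / (p - q)) * lam ^ (n + 1) := by
  have hp0 : 0 < p := by linarith
  have hpq : 0 < p - q := by linarith
  have hl0 : 0 < lam := hlam ▸ div_pos hq0 hp0
  have hl1 : lam < 1 := by rw [hlam, div_lt_one hp0]; linarith
  have hinv : 1 / p = 1 + lam := by
    rw [hlam]
    field_simp
    linarith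
  have hL : 1 / (p - q) = (1 + lam) / (1 - lam) := by
    rw [← hinv, hlam]
    field_simp
  have hL1 : 1 ≤ 1 / (p - q) := by
    rw [one_le_div hpq]
    linarith
  intro n
  induction n with
  | zero => simpa [hu0] using hL1
  | succ n ih =>
    obtain ⟨ih0, ih1⟩ := ih
    have hrec := gap_recursion hl0 hl1 n (u n)
    have hun := hu (n + 1) (Nat.le_add_left 1 n)
    rw [hinv, Nat.add_sub_cancel] at hun
    rw [← hun, ← hL] at hrec
    obtain ⟨ha0, ha1⟩ := one_sub_pow_div_mem_Icc hl0 hl1 (k := n + 1) (m := n + 3)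
      (by omega) (by omega)
    obtain ⟨hb0, hb1⟩ := one_sub_pow_div_mem_Icc hl0 hl1 (k := 1) (m := n + 3)
      (by omega) (by omega)
    rw [pow_one] at hb0 hb1
    have hc : 0 ≤ 2 * (1 / (p - q)) * lam ^ (n + 2) := by positivity
    rw [hrec]
    refine ⟨by positivity, ?_⟩
    calc
      _ ≤ lam * 1 * (1 / (p - q) - u n) + 2 * (1 / (p - q)) * lam ^ (n + 2) * 1 := by gcongr
      _ ≤ lam * 1 * (lam ^ n * (1 / (p - q) - 1) + (2 * (n : ℝ) / (p - q)) * lam ^ (n + 1)) +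
          2 * (1 / (p - q)) * lam ^ (n + 2) * 1 := by gcongr
      _ = _ := by
        push_cast
        ring
end

section
/- Fix an integer A ≥ 2 and set p = 1−q and λ = q/p for q ∈ (0,1/2). Define the apparent hashrate of the A-Trail-Stubborn miner with γ = 0 as the function f(q) = [ ((p + pq − q²)/(p−q))·q + pq·( (1 + (1/p)·(1 − A·λ^{A−1} + A·λ^{A+1} − λ^{2A})/((1−λ)(1−λ^{A−1})(1−λ^{A+1})))·(λ² − λ^{A+1})/(1 − λ^{A+1}) − (p/(p−q))·(1−λ²)/(1−λ^{A+1}) ) ] / [ 1 + (pq/(p−q))·(A·p + q)·(1−λ²)/(1−λ^{A+1}) ]. Then lim_{q→(1/2)⁻} f(q) = 1 − 1/(A+1) = A/(A+1). -/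
open Filter Topology

/-- The geometric quotient `(1 - x ^ n) / (1 - x)` tends to `n` at `1`. -/
theorem tendsto_one_sub_pow_div_one_sub (n : ℕ) :
    Tendsto (fun x : ℝ => (1 - x ^ n) / (1 - x)) (𝓝[≠] 1) (𝓝 n) := by
  have h := hasDerivAt_iff_tendsto_slope.1 (hasDerivAt_pow n (1 : ℝ))
  simp only [one_pow, mul_one] at h
  refine h.congr fun x => ?_
  rw [slope_def_field, one_pow, ← neg_sub, ← neg_sub 1 x, neg_div_neg_eq]

/-- The polynomial `1 - n x ^ (n - 1) + n x ^ (n + 1) - x ^ (2 n)` vanishes at `1` to an order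
greater than two. -/
theorem tendsto_antipalindromic_div_sq {n : ℕ} (hn : 1 ≤ n) :
    Tendsto
      (fun x : ℝ =>
        (1 - (n : ℝ) * x ^ (n - 1) + (n : ℝ) * x ^ (n + 1) - x ^ (2 * n)) / (1 - x) ^ 2)
      (𝓝[≠] 1) (𝓝 0) := by
  obtain ⟨m, rfl⟩ := Nat.exists_eq_add_of_le' hn
  set g : ℝ → ℝ := fun x =>
    ∑ i ∈ Finset.range (2 * (m + 1)), x ^ i - ((m + 1 : ℕ) : ℝ) * (x ^ m + x ^ (m + 1)) with hg
  have hd : HasDerivAt g 0 1 := by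
    have h1 : HasDerivAt (fun x : ℝ => ∑ i ∈ Finset.range (2 * (m + 1)), x ^ i)
        (∑ i ∈ Finset.range (2 * (m + 1)), (i : ℝ) * 1 ^ (i - 1)) 1 :=
      HasDerivAt.fun_sum fun i _ => hasDerivAt_pow i 1
    have h2 := h1.sub
      (((hasDerivAt_pow m (1 : ℝ)).add (hasDerivAt_pow (m + 1) 1)).const_mul ((m + 1 : ℕ) : ℝ))
    refine h2.congr_deriv ?_
    have h3 : (∑ i ∈ Finset.range (2 * (m + 1)), (i : ℝ)) * 2 = 2 * (m + 1) * (2 * m + 1) := by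
      have h := Finset.sum_range_id_mul_two (2 * (m + 1))
      rw [show 2 * (m + 1) - 1 = 2 * m + 1 by omega] at h
      have h' := congrArg (Nat.cast : ℕ → ℝ) h
      push_cast at h'
      exact h'
    simp only [one_pow, mul_one]
    push_cast
    linarith
  have h := (hasDerivAt_iff_tendsto_slope.1 hd).neg
  rw [neg_zero] at h
  refine h.congr' ?_
  filter_upwards [self_mem_nhdsWithin] with x hx
  have hg1 : g 1 = 0 := by
    simp only [hg, one_pow, Finset.sum_const, Finset.card_range, nsmul_eq_mul]
    push_cast
    ring
  have hgeom := mul_neg_geom_sum x (2 * (m + 1))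
  have hgx : 1 - ((m + 1 : ℕ) : ℝ) * x ^ (m + 1 - 1) + ((m + 1 : ℕ) : ℝ) * x ^ (m + 1 + 1)
      - x ^ (2 * (m + 1)) = (1 - x) * g x := by
    simp only [hg, mul_sub, hgeom, Nat.add_sub_cancel]
    ring
  rw [slope_def_field, hg1, hgx, sub_zero, ← neg_sub 1 x]
  field_simp

/-- For `γ = 0`, the apparent hashrate of the `A`-Trail-Stubborn mining strategy tends to
`1 - 1/(A+1) = A/(A+1)` as `q → (1/2)⁻`. -/
theorem tendsto_apparent_hashrate_TSM (A : ℕ) (hA : 2 ≤ A) :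
    Tendsto
      (fun q : ℝ =>
        let p : ℝ := 1 - q
        let l : ℝ := q / p
        (((p + p * q - q ^ 2) / (p - q)) * q +
            p * q *
              ((1 + (1 / p) *
                    ((1 - (A : ℝ) * l ^ (A - 1) + (A : ℝ) * l ^ (A + 1) - l ^ (2 * A)) /
                      ((1 - l) * (1 - l ^ (A - 1)) * (1 - l ^ (A + 1))))) *
                  ((l ^ 2 - l ^ (A + 1)) / (1 - l ^ (A + 1))) -
                (p / (p - q)) * ((1 - l ^ 2) / (1 - l ^ (A + 1))))) /
          (1 + (p * q / (p - q)) * (((A : ℝ) * p + q) * ((1 - l ^ 2) / (1 - l ^ (A + 1))))))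
      (𝓝[Set.Ioo 0 (1 / 2)] (1 / 2))
      (𝓝 ((A : ℝ) / ((A : ℝ) + 1))) := by
  have hid : Tendsto (fun q : ℝ => q) (𝓝[Set.Ioo 0 (1 / 2)] (1 / 2)) (𝓝 (1 / 2)) :=
    tendsto_nhdsWithin_of_tendsto_nhds tendsto_id
  have hp : Tendsto (fun q : ℝ => 1 - q) (𝓝[Set.Ioo 0 (1 / 2)] (1 / 2)) (𝓝 (1 / 2)) := by
    have h := hid.const_sub 1
    norm_num at h ⊢
    exact h
  have hl : Tendsto (fun q : ℝ => q / (1 - q)) (𝓝[Set.Ioo 0 (1 / 2)] (1 / 2)) (𝓝[≠] 1) := by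
    refine tendsto_nhdsWithin_iff.2 ⟨?_, ?_⟩
    · have h := hid.div hp (by norm_num)
      rwa [div_self (by norm_num)] at h
    · filter_upwards [self_mem_nhdsWithin] with q hq
      have h1 : q / (1 - q) < 1 := by
        rw [div_lt_one (by linarith [hq.2])]
        linarith [hq.2]
      exact h1.ne
  have hA1 : ((A - 1 : ℕ) : ℝ) ≠ 0 := Nat.cast_ne_zero.2 (by omega)
  have hA2 : ((A + 1 : ℕ) : ℝ) ≠ 0 := Nat.cast_ne_zero.2 (by omega)
  have hr (n : ℕ) := (tendsto_one_sub_pow_div_one_sub n).comp hl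
  have hN := (tendsto_antipalindromic_div_sq (show 1 ≤ A by omega)).comp hl
  have hE := hN.div ((hr (A - 1)).mul (hr (A + 1))) (mul_ne_zero hA1 hA2)
  have hR := (hr 2).div (hr (A + 1)) hA2
  have hpq := hp.mul hid
  have hnum := (((hp.add hpq).sub (hid.pow 2)).mul hid).add
    (hpq.mul ((((hp.sub hid).add hE).mul (hR.const_sub 1)).sub (hp.mul hR)))
  have hden := (hp.sub hid).add (hpq.mul (((hp.const_mul (A : ℝ)).add hid).mul hR))
  have hden0 : (1 / 2 - 1 / 2 : ℝ) +
      1 / 2 * (1 / 2) * (((A : ℝ) * (1 / 2) + 1 / 2) * (((2 : ℕ) : ℝ) / ((A + 1 : ℕ) : ℝ))) =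
        1 / 4 := by
    push_cast
    field_simp
    ring
  have h := hnum.div hden (by rw [hden0]; norm_num)
  rw [hden0] at h
  refine (h.congr' ?_).trans_eq ?_
  · filter_upwards [self_mem_nhdsWithin] with q hq
    obtain ⟨hq0, hq1⟩ := hq
    have hp0 : 0 < 1 - q := by linarith
    have hl0 : 0 < q / (1 - q) := div_pos hq0 hp0
    have hl1 : q / (1 - q) < 1 := by
      rw [div_lt_one hp0]
      linarith
    have hd : 1 - q - q = (1 - q) * (1 - q / (1 - q)) := by
      field_simp
    have hd0 : 1 - q - q ≠ 0 := by linarith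
    have hpow {n : ℕ} (hn : n ≠ 0) : 1 - (q / (1 - q)) ^ n ≠ 0 :=
      (sub_pos.2 (pow_lt_one₀ hl0.le hl1 hn)).ne'
    have h1 := hpow (show A - 1 ≠ 0 by omega)
    have h2 := hpow (show A + 1 ≠ 0 by omega)
    have h3 : 1 - q / (1 - q) ≠ 0 := (sub_pos.2 hl1).ne'
    rw [hd] at hd0
    simp only [Function.comp_apply, Pi.div_apply, hd]
    generalize q / (1 - q) = l at *
    generalize 1 - (A : ℝ) * l ^ (A - 1) + (A : ℝ) * l ^ (A + 1) - l ^ (2 * A) = N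
    generalize l ^ (A - 1) = a at *
    generalize l ^ (A + 1) = b at *
    generalize 1 - q = p at *
    refine Eq.trans ?_ (mul_div_mul_left _ _ hd0)
    congr 1
    · field_simp
      ring
    · field_simp
  · congr 1
    push_cast
    field_simp
    ring
end

section
/- (Mixed strategies are barycenters) Let n ≥ 1, τ₀ > 0, and for i = 1,…,n let τ_i > 0, R_i ∈ ℝ and D_i > 0 be given. Define Γ̃_i = (R_i/τ_i)·D_i, the weights μ_i = τ_i/(τ₀·D_i) and μ = Σ_{i=1}^n μ_i, the mixed difficulty D = (Σ_{i=1}^n τ_i)/(τ₀·μ), and the mixed apparent revenue ratio Γ̃ = ((Σ_{i=1}^n R_i)/(Σ_{i=1}^n τ_i))·D. Then D = Σ_{i=1}^n (μ_i/μ)·D_i and Γ̃ = Σ_{i=1}^n (μ_i/μ)·Γ̃_i; in particular (D, Γ̃) is the barycenter of the points (D_i, Γ̃_i) with weights μ_i, and consequently Γ̃ ≤ max_i Γ̃_i. -/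
/-- Mixed mining strategies: the difficulty and the apparent revenue ratio of a mixed
strategy are the barycenters, weighted by the weights `μᵢ`, of those of the component
strategies; consequently the apparent revenue ratio of the mixed strategy is at most the
maximum of those of the components. -/
theorem mixed_strategy_barycenter
    (n : ℕ) (hn : 1 ≤ n) (τ0 : ℝ) (hτ0 : 0 < τ0)
    (τ R D : Fin n → ℝ) (hτ : ∀ i, 0 < τ i) (hD : ∀ i, 0 < D i)
    (Γt : Fin n → ℝ) (hΓt : ∀ i, Γt i = (R i / τ i) * D i)
    (μ : Fin n → ℝ) (hμ : ∀ i, μ i = τ i / (τ0 * D i))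
    (μtot : ℝ) (hμtot : μtot = ∑ i, μ i)
    (Dmix : ℝ) (hDmix : Dmix = (∑ i, τ i) / (τ0 * μtot))
    (Γmix : ℝ) (hΓmix : Γmix = ((∑ i, R i) / (∑ i, τ i)) * Dmix) :
    Dmix = ∑ i, (μ i / μtot) * D i ∧
    Γmix = ∑ i, (μ i / μtot) * Γt i ∧
    Γmix ≤ Finset.univ.sup'
      (Finset.univ_nonempty_iff.mpr (Fin.pos_iff_nonempty.mp hn)) Γt := by
  have hne : (Finset.univ : Finset (Fin n)).Nonempty :=
    Finset.univ_nonempty_iff.mpr (Fin.pos_iff_nonempty.mp hn)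
  have hμ_pos : ∀ i, 0 < μ i := fun i => by
    rw [hμ]
    exact div_pos (hτ i) (mul_pos hτ0 (hD i))
  have hμtot_pos : 0 < μtot := hμtot ▸ Finset.sum_pos (fun i _ => hμ_pos i) hne
  have hτ_sum : 0 < ∑ i, τ i := Finset.sum_pos (fun i _ => hτ i) hne
  have hD_bary : Dmix = ∑ i, (μ i / μtot) * D i := by
    rw [hDmix, Finset.sum_div]
    refine Finset.sum_congr rfl fun i _ => ?_
    have := (hD i).ne'
    rw [hμ]
    field_simp
  have hΓ_bary : Γmix = ∑ i, (μ i / μtot) * Γt i := by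
    have hΓ_sum : Γmix = (∑ i, R i) / (τ0 * μtot) := by
      rw [hΓmix, hDmix, div_mul_div_cancel₀ hτ_sum.ne']
    rw [hΓ_sum, Finset.sum_div]
    refine Finset.sum_congr rfl fun i _ => ?_
    have := (hD i).ne'
    have := (hτ i).ne'
    rw [hμ, hΓt]
    field_simp
  refine ⟨hD_bary, hΓ_bary, ?_⟩
  have hweights : ∑ i, μ i / μtot = 1 := by
    rw [← Finset.sum_div, ← hμtot, div_self hμtot_pos.ne']
  calc Γmix = ∑ i, (μ i / μtot) * Γt i := hΓ_bary
    _ ≤ ∑ i, (μ i / μtot) * Finset.univ.sup' hne Γt :=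
      Finset.sum_le_sum fun i hi => mul_le_mul_of_nonneg_left (Finset.le_sup' Γt hi)
        (div_pos (hμ_pos i) hμtot_pos).le
    _ = Finset.univ.sup' hne Γt := by rw [← Finset.sum_mul, hweights, one_mul]
end
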